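/- arXiv:1212.3887 — 4 statements merged into one kernel-verified Lean document; each statement's English description precedes it below -/
import Mathlib

section
/- Let (a_n)_{n≥1} be a sequence of real numbers with ∑_{n=1}^∞ a_n² < ∞. Then ∑_{n=1}^∞ |a_n a_{n+1}| ≤ ∑_{n=1}^∞ (1 − 1/(8n²)) a_n². -/
theorem Real.sqrt_one_sub_add_sqrt_one_add_le {x : ℝ} (hx : |x| ≤ 1) :
    √(1 - x) + √(1 + x) ≤ 2 - x ^ 2 / 4 := by
  obtain ⟨hx₁, hx₂⟩ := abs_le.mp hx
  have hu := Real.sq_sqrt (show 0 ≤ 1 - x by linarith)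
  have hv := Real.sq_sqrt (show 0 ≤ 1 + x by linarith)
  have hx₃ : x ^ 2 ≤ 1 := by nlinarith
  have huv : √(1 - x) * √(1 + x) ≤ 1 - x ^ 2 / 2 := by
    refine abs_le_of_sq_le_sq' ?_ (by linarith) |>.2
    rw [mul_pow, hu, hv]
    nlinarith [sq_nonneg (x ^ 2)]
  refine abs_le_of_sq_le_sq' ?_ (by linarith) |>.2
  nlinarith [sq_nonneg (x ^ 2)]

theorem abs_mul_le_half_mul_sq_add_inv_mul_sq {c : ℝ} (hc : 0 < c) (x y : ℝ) :
    |x * y| ≤ c / 2 * x ^ 2 + c⁻¹ / 2 * y ^ 2 := by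
  rw [abs_mul, ← sq_abs x, ← sq_abs y]
  have key : c / 2 * |x| ^ 2 + c⁻¹ / 2 * |y| ^ 2 - |x| * |y| =
      c⁻¹ / 2 * (c * |x| - |y|) ^ 2 := by
    field_simp
    ring
  have : 0 ≤ c⁻¹ / 2 * (c * |x| - |y|) ^ 2 := by positivity
  linarith

/-- Finite form of the Hardy inequality, with the boundary term coming from the
ground state `n ↦ √n`. -/
theorem sum_range_abs_mul_succ_le (a : ℕ → ℝ) (N : ℕ) :
    ∑ n ∈ Finset.range N, |a (n + 1) * a (n + 2)| ≤
      ∑ n ∈ Finset.range N, (1 - 1 / (8 * ((n : ℝ) + 1) ^ 2)) * a (n + 1) ^ 2 +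
        √(1 - 1 / ((N : ℝ) + 1)) / 2 * a (N + 1) ^ 2 := by
  induction N with
  | zero => simp
  | succ N ih =>
    rw [Finset.sum_range_succ, Finset.sum_range_succ]
    have hN : (0 : ℝ) < (N : ℝ) + 1 := by positivity
    have hx : |1 / ((N : ℝ) + 1)| ≤ 1 := by
      rw [abs_of_pos (by positivity), div_le_one hN]
      linarith [Nat.cast_nonneg (α := ℝ) N]
    have hcoef := Real.sqrt_one_sub_add_sqrt_one_add_le hx
    have hinv : (√(1 + 1 / ((N : ℝ) + 1)))⁻¹ = √(1 - 1 / (((N + 1 : ℕ) : ℝ) + 1)) := by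
      rw [← Real.sqrt_inv]
      congr 1
      push_cast
      field_simp
      ring
    have hxy := abs_mul_le_half_mul_sq_add_inv_mul_sq
      (c := √(1 + 1 / ((N : ℝ) + 1))) (by positivity) (a (N + 1)) (a (N + 2))
    rw [hinv] at hxy
    have hmul := mul_le_mul_of_nonneg_right hcoef (sq_nonneg (a (N + 1)))
    have hsq : 1 / (8 * ((N : ℝ) + 1) ^ 2) = (1 / ((N : ℝ) + 1)) ^ 2 / 8 := by
      field_simp
    rw [hsq]
    linarith

/-- **Lemma 3.1.** If `(a n)_{n ≥ 1}` is a sequence of real numbers with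
`∑_{n=1}^∞ a n ^ 2 < ∞`, then `∑_{n=1}^∞ |a n * a (n+1)| ≤ ∑_{n=1}^∞ (1 - 1/(8 n^2)) * a n ^ 2`. -/
theorem hardy_sequence_inequality (a : ℕ → ℝ)
    (h : Summable (fun n : ℕ => a (n + 1) ^ 2)) :
    ∑' n : ℕ, |a (n + 1) * a (n + 2)| ≤
      ∑' n : ℕ, (1 - 1 / (8 * ((n : ℝ) + 1) ^ 2)) * a (n + 1) ^ 2 := by
  have hweight (n : ℕ) : 1 / (8 * ((n : ℝ) + 1) ^ 2) ≤ 1 / 8 := by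
    have hn : (1 : ℝ) ≤ ((n : ℝ) + 1) ^ 2 := one_le_pow₀ (by simp)
    exact one_div_le_one_div_of_le (by norm_num) (by linarith)
  have hnonneg (n : ℕ) : 0 ≤ (1 - 1 / (8 * ((n : ℝ) + 1) ^ 2)) * a (n + 1) ^ 2 :=
    mul_nonneg (by linarith [hweight n]) (sq_nonneg _)
  have hsum : Summable fun n : ℕ => (1 - 1 / (8 * ((n : ℝ) + 1) ^ 2)) * a (n + 1) ^ 2 := by
    refine h.of_nonneg_of_le hnonneg fun n => mul_le_of_le_one_left (sq_nonneg _) ?_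
    have : 0 ≤ 1 / (8 * ((n : ℝ) + 1) ^ 2) := by positivity
    linarith
  refine Real.tsum_le_of_sum_range_le (fun n => abs_nonneg _) fun N => ?_
  refine (sum_range_abs_mul_succ_le a N).trans ?_
  refine le_trans ?_ (hsum.sum_le_tsum (Finset.range (N + 1)) fun n _ => hnonneg n)
  rw [Finset.sum_range_succ]
  gcongr
  have hsqrt : √(1 - 1 / ((N : ℝ) + 1)) ≤ 1 := by
    refine Real.sqrt_le_iff.mpr ⟨zero_le_one, ?_⟩
    have : 0 ≤ 1 / ((N : ℝ) + 1) := by positivity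
    linarith
  linarith [hweight N]
end

section
/- Let f : ℝ → ℝ be 2π-periodic and continuously differentiable with ∫₀^{2π} f(θ) dθ = 0. Then ∫₀^{2π} (1 − cos θ) f′(θ)² dθ ≥ (1/8) ∫₀^{2π} f(θ)² dθ. -/
open Real

/-- One-sided Hardy inequality with weight `1 - cos θ` on `[0, π]`, for functions vanishing
at `π`. -/
theorem hardy_one_sub_cos_half {g : ℝ → ℝ} (hg : ContDiff ℝ 1 g) (hgpi : g π = 0) :
    (1 / 8) * ∫ θ in (0 : ℝ)..π, g θ ^ 2 ≤
      ∫ θ in (0 : ℝ)..π, (1 - cos θ) * (deriv g θ) ^ 2 := by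
  have hgc : Continuous g := hg.continuous
  have hgc' : Continuous (deriv g) := hg.continuous_deriv le_rfl
  have hpos : ∀ θ ∈ Set.Icc 0 π, 0 < 2 * cos (θ / 2) + 1 := fun θ hθ => by
    have : 0 ≤ cos (θ / 2) := cos_nonneg_of_mem_Icc ⟨by linarith [hθ.1, pi_pos], by linarith [hθ.2]⟩
    linarith
  have huIcc : Set.uIcc 0 π = Set.Icc 0 π := Set.uIcc_of_le pi_pos.le
  set y : ℝ → ℝ := fun θ => 3 / 2 / (2 * cos (θ / 2) + 1) with hy
  set φ : ℝ → ℝ := fun θ =>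
    2 * (sin (θ / 2) * deriv g θ) * y θ * g θ +
      (cos (θ / 2) * y θ / 2 + 3 / 2 * sin (θ / 2) ^ 2 / (2 * cos (θ / 2) + 1) ^ 2) * g θ ^ 2
    with hφ
  have hderiv : ∀ θ ∈ Set.uIcc 0 π,
      HasDerivAt (fun θ => sin (θ / 2) * y θ * g θ ^ 2) (φ θ) θ := fun θ hθ => by
    have hD := (hpos θ (huIcc ▸ hθ)).ne'
    have hhalf : HasDerivAt (fun θ : ℝ => θ / 2) (1 / 2) θ := (hasDerivAt_id θ).div_const 2
    have hgd := (hg.differentiable one_ne_zero θ).hasDerivAt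
    have h := (hhalf.sin.mul
      ((hasDerivAt_const θ (3 / 2 : ℝ)).div ((hhalf.cos.const_mul 2).add_const 1) hD)).mul
        (hgd.pow 2)
    refine h.congr_deriv ?_
    simp only [hφ, hy, Pi.mul_apply, Pi.div_apply, Pi.pow_apply]
    field_simp
    ring
  have hφc : ContinuousOn φ (Set.uIcc 0 π) := by
    have hyc : ContinuousOn y (Set.uIcc 0 π) :=
      continuousOn_const.div (by fun_prop) fun θ hθ => (hpos θ (huIcc ▸ hθ)).ne'
    have hquot : ContinuousOn
        (fun θ => 3 / 2 * sin (θ / 2) ^ 2 / (2 * cos (θ / 2) + 1) ^ 2) (Set.uIcc 0 π) :=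
      ContinuousOn.div (by fun_prop) (by fun_prop)
        fun θ hθ => pow_ne_zero 2 (hpos θ (huIcc ▸ hθ)).ne'
    fun_prop
  have hφint : ∫ θ in (0 : ℝ)..π, φ θ = 0 := by
    rw [intervalIntegral.integral_eq_sub_of_hasDerivAt hderiv hφc.intervalIntegrable]
    simp [hgpi]
  have hφi := hφc.intervalIntegrable (μ := MeasureTheory.volume)
  have hwi : IntervalIntegrable (fun θ => (1 - cos θ) * (deriv g θ) ^ 2)
      MeasureTheory.volume 0 π := Continuous.intervalIntegrable (by fun_prop) _ _
  have hgi : IntervalIntegrable (fun θ => 1 / 8 * g θ ^ 2)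
      MeasureTheory.volume 0 π := Continuous.intervalIntegrable (by fun_prop) _ _
  have hmono := intervalIntegral.integral_mono_on pi_pos.le hgi (hwi.add hφi) fun θ hθ => by
    have hD := hpos θ hθ
    have hs : sin (θ / 2) ^ 2 = 1 - cos (θ / 2) ^ 2 := sin_sq (θ / 2)
    have hw : 1 - cos θ = 2 * sin (θ / 2) ^ 2 := by
      rw [hs, show θ = 2 * (θ / 2) by ring, cos_two_mul]
      ring_nf
    have hkey : (1 - cos θ) * deriv g θ ^ 2 + φ θ - 1 / 8 * g θ ^ 2 =
        2 * (sin (θ / 2) * deriv g θ + y θ * g θ / 2) ^ 2 +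
          (1 - cos (θ / 2)) / (4 * (2 * cos (θ / 2) + 1)) * g θ ^ 2 := by
      rw [hw]
      simp only [hφ, hy]
      linear_combination (norm := skip) 3 / 2 / (2 * cos (θ / 2) + 1) ^ 2 * g θ ^ 2 * hs
      field_simp
      ring
    have hc := cos_le_one (θ / 2)
    have : 0 ≤ (1 - cos (θ / 2)) / (4 * (2 * cos (θ / 2) + 1)) :=
      div_nonneg (by linarith) (by linarith)
    have : 0 ≤ (1 - cos θ) * deriv g θ ^ 2 + φ θ - 1 / 8 * g θ ^ 2 := by
      rw [hkey]
      positivity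
    linarith
  rw [intervalIntegral.integral_const_mul, intervalIntegral.integral_add hwi hφi, hφint,
    add_zero] at hmono
  exact hmono

/-- Hardy inequality with weight `1 - cos θ` on `[0, 2π]`, for functions vanishing at `π`. -/
theorem hardy_one_sub_cos {g : ℝ → ℝ} (hg : ContDiff ℝ 1 g) (hgpi : g π = 0) :
    (1 / 8) * ∫ θ in (0 : ℝ)..(2 * π), g θ ^ 2 ≤
      ∫ θ in (0 : ℝ)..(2 * π), (1 - cos θ) * (deriv g θ) ^ 2 := by
  have hgc : Continuous g := hg.continuous
  have hgc' : Continuous (deriv g) := hg.continuous_deriv le_rfl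
  have hleft := hardy_one_sub_cos_half hg hgpi
  have hright := hardy_one_sub_cos_half (g := fun θ => g (2 * π - θ))
    (hg.comp (contDiff_const.sub contDiff_id)) (by simpa [two_mul] using hgpi)
  have hend : 2 * π - π = π := by ring
  have h₁ : ∫ θ in (0 : ℝ)..π, g (2 * π - θ) ^ 2 = ∫ θ in π..(2 * π), g θ ^ 2 := by
    rw [intervalIntegral.integral_comp_sub_left (fun θ => g θ ^ 2), hend, sub_zero]
  have h₂ : ∫ θ in (0 : ℝ)..π, (1 - cos θ) * (deriv (fun θ => g (2 * π - θ)) θ) ^ 2 =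
      ∫ θ in π..(2 * π), (1 - cos θ) * (deriv g θ) ^ 2 := by
    have h := intervalIntegral.integral_comp_sub_left (a := 0) (b := π)
      (fun θ => (1 - cos θ) * (deriv g θ) ^ 2) (2 * π)
    rw [hend, sub_zero] at h
    simpa [deriv_comp_const_sub, cos_two_pi_sub] using h
  rw [h₁, h₂] at hright
  rw [← intervalIntegral.integral_add_adjacent_intervals (b := π)
      (f := fun θ => g θ ^ 2) (Continuous.intervalIntegrable (by fun_prop) _ _)
      (Continuous.intervalIntegrable (by fun_prop) _ _),
    ← intervalIntegral.integral_add_adjacent_intervals (b := π)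
      (f := fun θ => (1 - cos θ) * (deriv g θ) ^ 2)
      (Continuous.intervalIntegrable (by fun_prop) _ _)
      (Continuous.intervalIntegrable (by fun_prop) _ _)]
  linarith

/-- Among all translates by a constant, a zero-mean function has the smallest `L²` norm. -/
theorem integral_sq_le_integral_sub_const_sq {f : ℝ → ℝ} (hf : Continuous f) {a b : ℝ}
    (hab : a ≤ b) (hmean : ∫ θ in a..b, f θ = 0) (c : ℝ) :
    ∫ θ in a..b, f θ ^ 2 ≤ ∫ θ in a..b, (f θ - c) ^ 2 := by
  have h : ∀ θ, (f θ - c) ^ 2 = f θ ^ 2 - 2 * c * f θ + c ^ 2 := fun θ => by ring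
  simp only [h]
  rw [intervalIntegral.integral_add (Continuous.intervalIntegrable (by fun_prop) _ _)
      (Continuous.intervalIntegrable (by fun_prop) _ _),
    intervalIntegral.integral_sub (Continuous.intervalIntegrable (by fun_prop) _ _)
      (Continuous.intervalIntegrable (by fun_prop) _ _),
    intervalIntegral.integral_const_mul, hmean, intervalIntegral.integral_const, smul_eq_mul]
  have := mul_nonneg (sub_nonneg.2 hab) (sq_nonneg c)
  linarith

/-- **Hardy–Rellich inequality on the circle `S¹`.** If `f : ℝ → ℝ` is `2π`-periodic,
continuously differentiable and has zero mean over `[0, 2π]`, then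
`∫₀^{2π} (1 - cos θ) f'(θ)² dθ ≥ (1/8) ∫₀^{2π} f(θ)² dθ`. -/
theorem hardy_rellich_circle (f : ℝ → ℝ)
    (hper : Function.Periodic f (2 * Real.pi))
    (hf : ContDiff ℝ 1 f)
    (hmean : ∫ θ in (0 : ℝ)..(2 * Real.pi), f θ = 0) :
    (1 / 8) * ∫ θ in (0 : ℝ)..(2 * Real.pi), f θ ^ 2 ≤
      ∫ θ in (0 : ℝ)..(2 * Real.pi), (1 - Real.cos θ) * (deriv f θ) ^ 2 := by
  have hmin := integral_sq_le_integral_sub_const_sq hf.continuous two_pi_pos.le hmean (f π)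
  have hhardy := hardy_one_sub_cos (hf.sub contDiff_const) (sub_self (f π))
  simp only [deriv_sub_const_fun] at hhardy
  linarith
end

section
/- Let λ > −1/2 with λ ∉ {0, 1/2}. There exists a constant C_λ > 0 depending only on λ with the following property: for every real polynomial f whose Gegenbauer coefficient f̂_0^λ vanishes, letting g be the real polynomial with ĝ_0^λ = 0 and ĝ_n^λ = (n(n+2λ))^{1/2} f̂_n^λ for all n ≥ 1, one has c_λ ∫_{−1}^{1} f(t)² w_λ(t) dt ≤ C_λ · c_λ ∫_{−1}^{1} (1−t) g(t)² w_λ(t) dt. -/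
open MeasureTheory Real

/-- The Gegenbauer weight `w_λ(t) = (1-t²)^{λ-1/2}` on `[-1,1]`. -/
noncomputable def gegenWeight (lam t : ℝ) : ℝ := (1 - t ^ 2) ^ (lam - 1 / 2)

/-- The normalization constant `c_λ = Γ(λ+1)/(√π Γ(λ+1/2))`,
so that `c_λ ∫_{-1}^1 w_λ(t) dt = 1`. -/
noncomputable def gegenConst (lam : ℝ) : ℝ :=
  Real.Gamma (lam + 1) / (Real.sqrt Real.pi * Real.Gamma (lam + 1 / 2))

/-- The Gegenbauer polynomials `C_n^λ`, defined by the three-term recurrence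
`C_0^λ(t) = 1`, `C_1^λ(t) = 2λt`,
`n C_n^λ(t) = 2(n+λ-1) t C_{n-1}^λ(t) - (n+2λ-2) C_{n-2}^λ(t)`. -/
noncomputable def gegenPoly (lam : ℝ) : ℕ → ℝ → ℝ
  | 0 => fun _ => 1
  | 1 => fun t => 2 * lam * t
  | (n + 2) => fun t =>
      (2 * ((n : ℝ) + 2 + lam - 1) * t * gegenPoly lam (n + 1) t
        - ((n : ℝ) + 2 + 2 * lam - 2) * gegenPoly lam n t) / ((n : ℝ) + 2)

/-- The normalization `h_n^λ = λ (2λ)_n / ((n+λ) n!)`. -/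
noncomputable def gegenNorm (lam : ℝ) (n : ℕ) : ℝ :=
  lam * (ascPochhammer ℝ n).eval (2 * lam) / (((n : ℝ) + lam) * (n.factorial : ℝ))

/-- The Gegenbauer coefficients
`f̂_n^λ = (h_n^λ)^{-1/2} c_λ ∫_{-1}^1 f(s) C_n^λ(s) w_λ(s) ds`. -/
noncomputable def gegenCoeff (lam : ℝ) (f : ℝ → ℝ) (n : ℕ) : ℝ :=
  (Real.sqrt (gegenNorm lam n))⁻¹ * gegenConst lam *
    ∫ s in (-1 : ℝ)..1, f s * gegenPoly lam n s * gegenWeight lam s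

/-- `γ_n = ((n+2λ)(n+1)/((n+λ)(n+λ+1)))^{1/2}`. -/
noncomputable def gegenGamma (lam : ℝ) (n : ℕ) : ℝ :=
  Real.sqrt (((n : ℝ) + 2 * lam) * ((n : ℝ) + 1) / (((n : ℝ) + lam) * ((n : ℝ) + lam + 1)))

section Helpers

open Polynomial

/-- The Gegenbauer polynomials as elements of `ℝ[X]`. -/
noncomputable def gegenPolynomial (lam : ℝ) : ℕ → ℝ[X]
  | 0 => 1
  | 1 => C (2 * lam) * X
  | (n + 2) => C ((n : ℝ) + 2)⁻¹ *
      (C (2 * ((n : ℝ) + 2 + lam - 1)) * X * gegenPolynomial lam (n + 1)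
        - C ((n : ℝ) + 2 + 2 * lam - 2) * gegenPolynomial lam n)

theorem eval_gegenPolynomial (lam t : ℝ) (n : ℕ) :
    (gegenPolynomial lam n).eval t = gegenPoly lam n t := by
  induction n using Nat.twoStepInduction with
  | zero => simp [gegenPolynomial, gegenPoly]
  | one => simp [gegenPolynomial, gegenPoly]
  | more n h0 h1 =>
    simp only [gegenPolynomial, gegenPoly, eval_mul, eval_sub, eval_C, eval_X, h0, h1]
    ring

theorem gegenPolynomial_recurrence (lam : ℝ) (n : ℕ) :
    ((n : ℝ[X]) + 2) * gegenPolynomial lam (n + 2) =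
      2 * ((n : ℝ[X]) + 1 + C lam) * X * gegenPolynomial lam (n + 1)
        - ((n : ℝ[X]) + 2 * C lam) * gegenPolynomial lam n := by
  have h : ((n : ℝ[X]) + 2) * C ((n : ℝ) + 2)⁻¹ = 1 := by
    have h2 : ((n : ℝ[X]) + 2) = C ((n : ℝ) + 2) := by simp only [C_add, map_natCast, map_ofNat]
    rw [h2, ← C_mul, mul_inv_cancel₀ (by positivity), C_1]
  rw [gegenPolynomial, ← mul_assoc, h, one_mul]
  simp only [C_mul, C_add, C_sub, map_natCast, map_ofNat, C_1]
  ring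

theorem gegenPolynomial_derivative (lam : ℝ) (n : ℕ) :
    (1 - X ^ 2) * derivative (gegenPolynomial lam n) =
        ((n : ℝ[X]) + 2 * C lam) * X * gegenPolynomial lam n - ((n : ℝ[X]) + 1) * gegenPolynomial lam (n + 1) ∧
      (1 - X ^ 2) * derivative (gegenPolynomial lam (n + 1)) =
        -((n : ℝ[X]) + 1) * X * gegenPolynomial lam (n + 1)
          + ((n : ℝ[X]) + 2 * C lam) * gegenPolynomial lam n := by
  induction n with
  | zero =>
    simp only [gegenPolynomial, derivative_one, derivative_mul, derivative_C, derivative_X, C_mul,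
      map_ofNat, Nat.cast_zero]
    constructor
    · ring
    · simp only [derivative_ofNat]
      ring
  | succ n ih =>
    obtain ⟨h1, h2⟩ := ih
    have hr := gegenPolynomial_recurrence lam n
    have hd := congrArg derivative hr
    simp only [derivative_mul, derivative_sub, derivative_add, derivative_natCast,
      derivative_ofNat, derivative_X, derivative_C, derivative_one] at hd
    have hn : ((n : ℝ[X]) + 2) ≠ 0 := by exact_mod_cast (by omega : n + 2 ≠ 0)
    push_cast
    constructor
    · linear_combination h2 + hr
    · apply mul_left_cancel₀ hn
      linear_combination (1 - X ^ 2) * hd + 2 * (n + 1 + C lam) * X * h2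
        - (n + 2 * C lam) * h1 + (n + 2) * X * hr

theorem one_sub_X_sq_ne_zero : (1 - X ^ 2 : ℝ[X]) ≠ 0 := by
  intro h
  simpa using congrArg (eval 0) h

/-- The Gegenbauer differential equation. -/
theorem gegenPolynomial_ode (lam : ℝ) (n : ℕ) :
    (1 - X ^ 2) * derivative (derivative (gegenPolynomial lam n))
        - (2 * C lam + 1) * X * derivative (gegenPolynomial lam n)
      = -((n : ℝ[X]) * ((n : ℝ[X]) + 2 * C lam)) * gegenPolynomial lam n := by
  obtain ⟨h1, h2⟩ := gegenPolynomial_derivative lam n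
  have hd := congrArg derivative h1
  simp only [derivative_mul, derivative_sub, derivative_add, derivative_natCast,
    derivative_ofNat, derivative_X, derivative_C, derivative_one, derivative_X_pow] at hd
  apply mul_left_cancel₀ one_sub_X_sq_ne_zero
  have hC : (C ((2 : ℕ) : ℝ) : ℝ[X]) = 2 := by
    rw [Nat.cast_ofNat]
    exact map_ofNat C 2
  rw [hC] at hd
  linear_combination (1 - X ^ 2) * hd - (n + 1) * h2 - (-(n + 2 * C lam) * X
    + (2 * C lam + 1) * X - 2 * X) * h1

theorem span_gegenPolynomial {lam : ℝ} (hlam : -1 / 2 < lam) (hlam0 : lam ≠ 0) :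
    Submodule.span ℝ (Set.range (gegenPolynomial lam)) = ⊤ := by
  set S := Submodule.span ℝ (Set.range (gegenPolynomial lam))
  have hG : ∀ n, gegenPolynomial lam n ∈ S := fun n => Submodule.subset_span ⟨n, rfl⟩
  have hX : ∀ p ∈ S, X * p ∈ S := by
    intro p hp
    induction hp using Submodule.span_induction with
    | mem p hp =>
      obtain ⟨n, rfl⟩ := hp
      cases n with
      | zero =>
        have : X * gegenPolynomial lam 0 = (2 * lam)⁻¹ • gegenPolynomial lam 1 := by
          simp only [gegenPolynomial, smul_eq_C_mul]
          rw [← mul_assoc, ← C_mul, inv_mul_cancel₀ (by simpa using hlam0)]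
          simp
        rw [this]
        exact S.smul_mem _ (hG 1)
      | succ n =>
        have hne : 2 * ((n : ℝ) + 1 + lam) ≠ 0 := by
          have : (0 : ℝ) ≤ n := n.cast_nonneg
          linarith
        have : X * gegenPolynomial lam (n + 1) = (2 * ((n : ℝ) + 1 + lam))⁻¹ •
            (((n : ℝ) + 2) • gegenPolynomial lam (n + 2)
              + ((n : ℝ) + 2 * lam) • gegenPolynomial lam n) := by
          rw [eq_inv_smul_iff₀ hne]
          simp only [smul_eq_C_mul, C_mul, C_add, map_natCast, map_ofNat, C_1]
          linear_combination - gegenPolynomial_recurrence lam n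
        rw [this]
        exact S.smul_mem _ (S.add_mem (S.smul_mem _ (hG _)) (S.smul_mem _ (hG _)))
    | zero => simp
    | add p q _ _ hp hq => rw [mul_add]; exact S.add_mem hp hq
    | smul a p _ hp => rw [mul_smul_comm]; exact S.smul_mem _ hp
  rw [eq_top_iff]
  rintro p -
  induction p using Polynomial.induction_on' with
  | add p q hp hq => exact S.add_mem hp hq
  | monomial n a =>
    rw [← C_mul_X_pow_eq_monomial, ← smul_eq_C_mul]
    refine S.smul_mem _ ?_
    induction n with
    | zero => simpa [gegenPolynomial] using hG 0
    | succ n ih => rw [pow_succ']; exact hX _ ih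

theorem intervalIntegrable_gegenWeight {lam : ℝ} (hlam : -1 / 2 < lam) :
    IntervalIntegrable (gegenWeight lam) volume (-1) 1 := by
  have h01 : IntervalIntegrable (gegenWeight lam) volume 0 1 := by
    have h1 : IntervalIntegrable (fun t : ℝ => (1 - t) ^ (lam - 1 / 2)) volume 0 1 := by
      have := (intervalIntegral.intervalIntegrable_rpow' (a := 0) (b := 1)
        (r := lam - 1 / 2) (by linarith)).comp_sub_left 1
      simpa using this.symm
    have h2 : ContinuousOn (fun t : ℝ => (1 + t) ^ (lam - 1 / 2)) (Set.uIcc 0 1) := by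
      rw [Set.uIcc_of_le zero_le_one]
      refine ContinuousOn.rpow_const (by fun_prop) fun t ht => Or.inl ?_
      have := ht.1
      linarith
    refine (h1.mul_continuousOn h2).congr ?_
    intro t ht
    rw [Set.uIoc_of_le zero_le_one] at ht
    simp only [gegenWeight]
    rw [← Real.mul_rpow (by linarith [ht.2]) (by linarith [ht.1])]
    congr 1
    ring
  have h10 : IntervalIntegrable (gegenWeight lam) volume (-1) 0 := by
    have h : (fun t => gegenWeight lam (-t)) = gegenWeight lam := by
      funext t
      simp [gegenWeight]
    have h' := h01
    rw [IntervalIntegrable.iff_comp_neg, h, neg_zero] at h'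
    exact h'.symm
  exact h10.trans h01

theorem intervalIntegrable_eval_mul_gegenWeight {lam : ℝ} (hlam : -1 / 2 < lam) (p : ℝ[X]) :
    IntervalIntegrable (fun t => p.eval t * gegenWeight lam t) volume (-1) 1 :=
  (intervalIntegrable_gegenWeight hlam).continuousOn_mul p.continuous.continuousOn

/-- Integration of polynomials against the Gegenbauer weight. -/
noncomputable def gegenIntegral {lam : ℝ} (hlam : -1 / 2 < lam) : ℝ[X] →ₗ[ℝ] ℝ where
  toFun p := ∫ t in (-1 : ℝ)..1, p.eval t * gegenWeight lam t
  map_add' p q := by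
    simp only [eval_add, add_mul]
    exact intervalIntegral.integral_add (intervalIntegrable_eval_mul_gegenWeight hlam p)
      (intervalIntegrable_eval_mul_gegenWeight hlam q)
  map_smul' a p := by
    simp only [eval_smul, smul_eq_mul, mul_assoc, intervalIntegral.integral_const_mul,
      RingHom.id_apply]

theorem gegenIntegral_apply {lam : ℝ} (hlam : -1 / 2 < lam) (p : ℝ[X]) :
    gegenIntegral hlam p = ∫ t in (-1 : ℝ)..1, p.eval t * gegenWeight lam t := rfl

theorem gegenIntegral_one_pos {lam : ℝ} (hlam : -1 / 2 < lam) : 0 < gegenIntegral hlam 1 := by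
  rw [gegenIntegral_apply]
  refine intervalIntegral.intervalIntegral_pos_of_pos_on
    (intervalIntegrable_eval_mul_gegenWeight hlam 1) ?_ (by norm_num)
  intro t ht
  simp only [eval_one, one_mul, gegenWeight]
  exact Real.rpow_pos_of_pos (by nlinarith [ht.1, ht.2]) _

/-- Integration by parts: the derivative of `(1 - t²) p w_λ` integrates to zero. -/
theorem gegenIntegral_by_parts {lam : ℝ} (hlam : -1 / 2 < lam) (p : ℝ[X]) :
    gegenIntegral hlam ((1 - X ^ 2) * derivative p - (2 * C lam + 1) * X * p) = 0 := by
  rw [gegenIntegral_apply]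
  have key := intervalIntegral.integral_eq_sub_of_hasDerivAt_of_le (a := -1) (b := 1)
    (f := fun t : ℝ => p.eval t * (1 - t ^ 2) ^ (lam + 1 / 2))
    (f' := fun t : ℝ => ((1 - X ^ 2) * derivative p - (2 * C lam + 1) * X * p).eval t
      * gegenWeight lam t) (by norm_num) ?_ ?_
    (intervalIntegrable_eval_mul_gegenWeight hlam _)
  · rw [key]
    have : lam + 1 / 2 ≠ 0 := by linarith
    norm_num [Real.zero_rpow this]
  · exact p.continuous.continuousOn.mul
      (ContinuousOn.rpow_const (by fun_prop) fun t _ => Or.inr (by linarith))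
  · intro t ht
    have hpos : 0 < 1 - t ^ 2 := by nlinarith [ht.1, ht.2]
    have h1 : HasDerivAt (fun t : ℝ => 1 - t ^ 2) (-(2 * t)) t := by
      simpa using (hasDerivAt_pow 2 t).const_sub 1
    have h2 := (p.hasDerivAt t).mul (h1.rpow_const (p := lam + 1 / 2) (Or.inl hpos.ne'))
    refine h2.congr_deriv ?_
    have e1 : (1 - t ^ 2) ^ (lam + 1 / 2) = (1 - t ^ 2) * (1 - t ^ 2) ^ (lam - 1 / 2) := by
      rw [← Real.rpow_one_add' hpos.le (by linarith)]
      congr 1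
      ring
    have e2 : lam + 1 / 2 - 1 = lam - 1 / 2 := by ring
    rw [e1, e2]
    simp only [gegenWeight, eval_sub, eval_mul, eval_one, eval_pow, eval_X, eval_add, eval_C,
      eval_ofNat]
    ring

theorem gegenIntegral_orthogonal {lam : ℝ} (hlam : -1 / 2 < lam) {m n : ℕ} (hmn : m ≠ n) :
    gegenIntegral hlam (gegenPolynomial lam m * gegenPolynomial lam n) = 0 := by
  have h := gegenIntegral_by_parts hlam
    (derivative (gegenPolynomial lam m) * gegenPolynomial lam n
      - gegenPolynomial lam m * derivative (gegenPolynomial lam n))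
  have e : (1 - X ^ 2) * derivative (derivative (gegenPolynomial lam m) * gegenPolynomial lam n
      - gegenPolynomial lam m * derivative (gegenPolynomial lam n))
      - (2 * C lam + 1) * X * (derivative (gegenPolynomial lam m) * gegenPolynomial lam n
      - gegenPolynomial lam m * derivative (gegenPolynomial lam n))
      = ((n : ℝ) * (n + 2 * lam) - m * (m + 2 * lam)) •
        (gegenPolynomial lam m * gegenPolynomial lam n) := by
    simp only [smul_eq_C_mul, C_mul, C_add, C_sub, map_natCast, map_ofNat, derivative_sub,
      derivative_mul]
    linear_combination gegenPolynomial lam n * gegenPolynomial_ode lam m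
      - gegenPolynomial lam m * gegenPolynomial_ode lam n
  rw [e, map_smul, smul_eq_mul] at h
  refine (mul_eq_zero.mp h).resolve_left ?_
  have e2 : (n : ℝ) * (n + 2 * lam) - m * (m + 2 * lam) = (n - m) * (n + m + 2 * lam) := by ring
  rw [e2]
  refine mul_ne_zero (sub_ne_zero.mpr (by exact_mod_cast hmn.symm)) ?_
  have : (1 : ℝ) ≤ n + m := by exact_mod_cast (by omega : 1 ≤ n + m)
  linarith

theorem gegenIntegral_sq_succ {lam : ℝ} (hlam : -1 / 2 < lam) (n : ℕ) :
    ((n : ℝ) + 1) * ((n + 1 + lam) * gegenIntegral hlam (gegenPolynomial lam (n + 1) ^ 2)) =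
      (n + 2 * lam) * ((n + lam) * gegenIntegral hlam (gegenPolynomial lam n ^ 2)) := by
  have up : 2 * ((n : ℝ) + 1 + lam) * gegenIntegral hlam
        (X * gegenPolynomial lam (n + 1) * gegenPolynomial lam n)
      = (n + 2 * lam) * gegenIntegral hlam (gegenPolynomial lam n ^ 2) := by
    have h := gegenIntegral_orthogonal hlam (m := n + 2) (n := n) (by omega)
    have e : (2 * ((n : ℝ) + 1 + lam)) • (X * gegenPolynomial lam (n + 1) * gegenPolynomial lam n)
        = ((n : ℝ) + 2) • (gegenPolynomial lam (n + 2) * gegenPolynomial lam n)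
          + ((n : ℝ) + 2 * lam) • gegenPolynomial lam n ^ 2 := by
      simp only [smul_eq_C_mul, C_mul, C_add, map_natCast, map_ofNat, C_1]
      linear_combination -gegenPolynomial lam n * gegenPolynomial_recurrence lam n
    have h' := congrArg (gegenIntegral hlam) e
    simpa only [map_add, map_smul, smul_eq_mul, h, mul_zero, zero_add] using h'
  have down : ((n : ℝ) + 1) * gegenIntegral hlam (gegenPolynomial lam (n + 1) ^ 2)
      = 2 * (n + lam) * gegenIntegral hlam
        (X * gegenPolynomial lam (n + 1) * gegenPolynomial lam n) := by
    cases n with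
    | zero =>
      have e : gegenPolynomial lam 1 ^ 2 =
          (2 * lam) • (X * gegenPolynomial lam 1 * gegenPolynomial lam 0) := by
        simp only [gegenPolynomial, smul_eq_C_mul]
        ring
      have h' := congrArg (gegenIntegral hlam) e
      simp only [map_smul, smul_eq_mul] at h'
      simpa using h'
    | succ n =>
      have h := gegenIntegral_orthogonal hlam (m := n) (n := n + 2) (by omega)
      have e : ((n : ℝ) + 2) • gegenPolynomial lam (n + 2) ^ 2
          = (2 * ((n : ℝ) + 1 + lam)) •
            (X * gegenPolynomial lam (n + 2) * gegenPolynomial lam (n + 1))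
          - ((n : ℝ) + 2 * lam) • (gegenPolynomial lam n * gegenPolynomial lam (n + 2)) := by
        simp only [smul_eq_C_mul, C_mul, C_add, map_natCast, map_ofNat, C_1]
        linear_combination gegenPolynomial lam (n + 2) * gegenPolynomial_recurrence lam n
      have h' := congrArg (gegenIntegral hlam) e
      simp only [map_sub, map_smul, smul_eq_mul, h, mul_zero, sub_zero] at h'
      push_cast
      linear_combination h'
  linear_combination ((n : ℝ) + 1 + lam) * down + ((n : ℝ) + lam) * up

theorem pos_of_gegen_recurrence {lam : ℝ} (hlam : -1 / 2 < lam) (hlam0 : lam ≠ 0) {N : ℕ → ℝ}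
    (h0 : 0 < N 0)
    (hN : ∀ n : ℕ, ((n : ℝ) + 1) * ((n + 1 + lam) * N (n + 1)) =
      (n + 2 * lam) * ((n + lam) * N n)) (n : ℕ) : 0 < N n := by
  induction n with
  | zero => exact h0
  | succ n ih =>
    have hn : (0 : ℝ) ≤ n := n.cast_nonneg
    have hr : 0 < ((n : ℝ) + 2 * lam) * ((n + lam) * N n) := by
      rcases n with _ | n
      · have : 0 < lam ^ 2 := by positivity
        have h : 0 < lam ^ 2 * N 0 := by positivity
        simp only [Nat.cast_zero]
        linarith
      · have hn' : (0 : ℝ) ≤ n := n.cast_nonneg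
        push_cast
        exact mul_pos (by linarith) (mul_pos (by linarith) ih)
    rw [← hN] at hr
    have h1 := pos_of_mul_pos_right hr (by linarith)
    exact pos_of_mul_pos_right h1 (by linarith)

theorem gegenNorm_succ {lam : ℝ} (hlam : -1 / 2 < lam) (hlam0 : lam ≠ 0) (n : ℕ) :
    ((n : ℝ) + 1) * ((n + 1 + lam) * gegenNorm lam (n + 1)) =
      (n + 2 * lam) * ((n + lam) * gegenNorm lam n) := by
  have hn : (0 : ℝ) ≤ n := n.cast_nonneg
  have h1 : (n : ℝ) + 1 + lam ≠ 0 := by linarith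
  have h2 : (n : ℝ) + lam ≠ 0 := by
    rcases n with _ | n
    · simpa using hlam0
    · have hn' : (0 : ℝ) ≤ n := n.cast_nonneg
      push_cast
      linarith
  have h3 : (n.factorial : ℝ) ≠ 0 := by positivity
  simp only [gegenNorm, ascPochhammer_succ_eval, Nat.factorial_succ]
  push_cast
  field_simp
  ring

theorem gegenNorm_pos {lam : ℝ} (hlam : -1 / 2 < lam) (hlam0 : lam ≠ 0) (n : ℕ) :
    0 < gegenNorm lam n :=
  pos_of_gegen_recurrence hlam hlam0 (by simp [gegenNorm, hlam0]) (gegenNorm_succ hlam hlam0) n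

theorem gegenConst_pos {lam : ℝ} (hlam : -1 / 2 < lam) : 0 < gegenConst lam := by
  have h1 := Real.Gamma_pos_of_pos (s := lam + 1) (by linarith)
  have h2 := Real.Gamma_pos_of_pos (s := lam + 1 / 2) (by linarith)
  have := Real.sqrt_pos.mpr Real.pi_pos
  unfold gegenConst
  positivity

theorem gegenCoeff_eval {lam : ℝ} (hlam : -1 / 2 < lam) (p : ℝ[X]) (n : ℕ) :
    gegenCoeff lam (fun t => p.eval t) n = (Real.sqrt (gegenNorm lam n))⁻¹ * gegenConst lam *
      gegenIntegral hlam (p * gegenPolynomial lam n) := by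
  simp only [gegenCoeff, gegenIntegral_apply, eval_mul, eval_gegenPolynomial]

/-- A weighted discrete Hardy inequality. -/
theorem discrete_hardy {lam : ℝ} {m b : ℕ → ℝ} {M : ℕ}
    (hm : ∀ n, 0 < m (n + 1))
    (hrec : ∀ n : ℕ, ((n : ℝ) + 1) * m (n + 1) = (n + 2 * lam) * m n)
    (hb0 : b 0 = 0) (hbM : b M = 0) :
    (2 * lam - 1) ^ 2 * ∑ n ∈ Finset.range M, m n * b n ^ 2 / (n + 1) ≤
      2 * (3 + 2 * |lam|) *
        ∑ n ∈ Finset.range M, ((n : ℝ) + 1) * m (n + 1) * (b (n + 1) - b n) ^ 2 := by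
  set S := ∑ n ∈ Finset.range M, m n * b n ^ 2 / (n + 1) with hS
  set D := ∑ n ∈ Finset.range M, ((n : ℝ) + 1) * m (n + 1) * (b (n + 1) - b n) ^ 2 with hD
  set K := 3 + 2 * |lam| with hK
  have hK0 : 0 < K := by positivity
  have tele : ∑ n ∈ Finset.range M, (m (n + 1) * b (n + 1) ^ 2 - m n * b n ^ 2) = 0 := by
    rw [Finset.sum_range_sub (fun n => m n * b n ^ 2)]
    simp [hb0, hbM]
  have shift : ∑ n ∈ Finset.range M, m (n + 1) * b (n + 1) ^ 2 / (n + 2) = S := by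
    have h1 := Finset.sum_range_succ (fun n : ℕ => m n * b n ^ 2 / ((n : ℝ) + 1)) M
    rw [Finset.sum_range_succ'] at h1
    simp only [hb0, hbM] at h1
    rw [hS]
    simp only [ne_eq, OfNat.ofNat_ne_zero, not_false_eq_true, zero_pow, mul_zero, zero_div,
      add_zero] at h1
    rw [← h1]
    refine Finset.sum_congr rfl fun n _ => ?_
    push_cast
    ring
  have pt : ∀ n ∈ Finset.range M, 2 * (2 * lam - 1) ^ 2 * K * (m n * b n ^ 2 / (n + 1)) ≤
      2 * K * (2 * lam - 1) * (m (n + 1) * b (n + 1) ^ 2 - m n * b n ^ 2)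
      + 2 * K ^ 2 * (((n : ℝ) + 1) * m (n + 1) * (b (n + 1) - b n) ^ 2)
      + (2 * lam - 1) ^ 2 * ((K - 2) * (m n * b n ^ 2 / (n + 1))
        + 2 * (m (n + 1) * b (n + 1) ^ 2 / (n + 2))) := by
    intro n _
    have hn : (0 : ℝ) ≤ n := n.cast_nonneg
    have hx : m (n + 1) * b n ^ 2 / (n + 1) ≤ (K - 2) * (m n * b n ^ 2 / (n + 1)) := by
      rcases n with _ | n
      · simp [hb0]
      · have hmn := hm n
        have e : m (n + 1 + 1) = (((n + 1 : ℕ) : ℝ) + 2 * lam) * m (n + 1)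
            / (((n + 1 : ℕ) : ℝ) + 1) := by
          rw [eq_div_iff (by positivity), ← hrec]
          ring
        rw [← mul_div_assoc, ← mul_assoc]
        gcongr
        rw [e, div_le_iff₀ (by positivity), mul_right_comm]
        gcongr
        have := le_abs_self lam
        have := abs_nonneg lam
        rw [hK]
        nlinarith
    have hy : m (n + 1) * b (n + 1) ^ 2 / (n + 1) ≤
        2 * (m (n + 1) * b (n + 1) ^ 2 / (n + 2)) := by
      have := hm n
      rw [← mul_div_assoc, div_le_div_iff₀ (by positivity) (by positivity)]
      have h0 : 0 ≤ m (n + 1) * b (n + 1) ^ 2 := by positivity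
      nlinarith
    have e1 : (2 * lam - 1) * (m n * b n ^ 2 / (n + 1))
        = (m (n + 1) * b (n + 1) ^ 2 - m n * b n ^ 2)
          - m (n + 1) * (b (n + 1) ^ 2 - b n ^ 2) := by
      have h1 : (n : ℝ) + 1 ≠ 0 := by positivity
      field_simp
      linear_combination -(b n ^ 2) * hrec n
    have amgm : -(2 * K * (2 * lam - 1) * (m (n + 1) * (b (n + 1) ^ 2 - b n ^ 2))) ≤
        2 * K ^ 2 * (((n : ℝ) + 1) * m (n + 1) * (b (n + 1) - b n) ^ 2)
        + (2 * lam - 1) ^ 2 * (m (n + 1) * b n ^ 2 / (n + 1)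
          + m (n + 1) * b (n + 1) ^ 2 / (n + 1)) := by
      have := hm n
      have h1 : (n : ℝ) + 1 ≠ 0 := by positivity
      have hsq : 0 ≤ m (n + 1) / (n + 1) / 2 * ((2 * K * (n + 1) * (b (n + 1) - b n)
          + (2 * lam - 1) * (b (n + 1) + b n)) ^ 2
          + (2 * lam - 1) ^ 2 * (b (n + 1) - b n) ^ 2) := by
        positivity
      have e : m (n + 1) / (n + 1) / 2 * ((2 * K * (n + 1) * (b (n + 1) - b n)
          + (2 * lam - 1) * (b (n + 1) + b n)) ^ 2
          + (2 * lam - 1) ^ 2 * (b (n + 1) - b n) ^ 2) =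
          2 * K ^ 2 * (((n : ℝ) + 1) * m (n + 1) * (b (n + 1) - b n) ^ 2)
        + (2 * lam - 1) ^ 2 * (m (n + 1) * b n ^ 2 / (n + 1)
          + m (n + 1) * b (n + 1) ^ 2 / (n + 1))
        + 2 * K * (2 * lam - 1) * (m (n + 1) * (b (n + 1) ^ 2 - b n ^ 2)) := by
        field_simp
        ring
      linarith
    have hxy := mul_le_mul_of_nonneg_left (add_le_add hx hy) (sq_nonneg (2 * lam - 1))
    have e2 : 2 * (2 * lam - 1) ^ 2 * K * (m n * b n ^ 2 / (n + 1)) =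
        2 * K * (2 * lam - 1) * ((2 * lam - 1) * (m n * b n ^ 2 / (n + 1))) := by ring
    rw [e2, e1]
    linarith
  have sum_le := Finset.sum_le_sum pt
  simp only [Finset.sum_add_distrib, ← Finset.mul_sum, tele, shift] at sum_le
  rw [← hS, ← hD] at sum_le
  have : K * ((2 * lam - 1) ^ 2 * S) ≤ K * (2 * K * D) := by linarith
  exact le_of_mul_le_mul_left this hK0

theorem gegenIntegral_mul_gegenPolynomial {lam : ℝ} (hlam : -1 / 2 < lam) (c : ℕ →₀ ℝ) (n : ℕ) :
    gegenIntegral hlam ((c.sum fun i a => a • gegenPolynomial lam i) * gegenPolynomial lam n) =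
      c n * gegenIntegral hlam (gegenPolynomial lam n ^ 2) := by
  rw [Finsupp.sum, Finset.sum_mul, map_sum, Finset.sum_eq_single n]
  · rw [smul_mul_assoc, map_smul, smul_eq_mul, sq]
  · intro i _ hi
    rw [smul_mul_assoc, map_smul, gegenIntegral_orthogonal hlam hi, smul_zero]
  · intro hn
    rw [Finsupp.notMem_support_iff.mp hn]
    simp

theorem gegenIntegral_mul_self {lam : ℝ} (hlam : -1 / 2 < lam) (c : ℕ →₀ ℝ) {M : ℕ}
    (hM : ∀ n, M ≤ n → c n = 0) {p : ℝ[X]} (hp : (c.sum fun i a => a • gegenPolynomial lam i) = p)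
    (q : ℝ[X]) :
    gegenIntegral hlam (q * p) =
      ∑ n ∈ Finset.range M, c n * gegenIntegral hlam (q * gegenPolynomial lam n) := by
  rw [← hp, Finsupp.sum_of_support_subset (s := Finset.range M), Finset.mul_sum, map_sum]
  · simp only [mul_smul_comm, map_smul, smul_eq_mul]
  · intro n hn
    by_contra h
    exact Finsupp.mem_support_iff.mp hn (hM n (by simpa using h))
  · simp

theorem exists_gegen_expansion {lam : ℝ} (hlam : -1 / 2 < lam) (hlam0 : lam ≠ 0) (p : ℝ[X]) :
    ∃ c : ℕ →₀ ℝ, (c.sum fun i a => a • gegenPolynomial lam i) = p := by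
  rw [← Finsupp.mem_span_range_iff_exists_finsupp, span_gegenPolynomial hlam hlam0]
  exact Submodule.mem_top

/-- The form `∫ (1 - t) g² w_λ` as a weighted discrete Dirichlet energy. -/
theorem gegenIntegral_energy {lam : ℝ} (hlam : -1 / 2 < lam) (c : ℕ →₀ ℝ) {p : ℝ[X]} {b : ℕ → ℝ}
    {M : ℕ} (hp : (c.sum fun i a => a • gegenPolynomial lam i) = p)
    (hcb : ∀ n : ℕ, c n = ((n : ℝ) + lam) * b n) (hb0 : b 0 = 0) (hbM : ∀ n, M ≤ n → b n = 0) :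
    2 * gegenIntegral hlam ((1 - X) * p * p) =
      ∑ n ∈ Finset.range M, ((n : ℝ) + 1) *
        ((((n + 1 : ℕ) : ℝ) + lam) * gegenIntegral hlam (gegenPolynomial lam (n + 1) ^ 2)) *
          (b (n + 1) - b n) ^ 2 := by
  set m : ℕ → ℝ := fun n => ((n : ℝ) + lam) * gegenIntegral hlam (gegenPolynomial lam n ^ 2)
    with hm
  have hmrec : ∀ n : ℕ, ((n : ℝ) + 1) * m (n + 1) = (n + 2 * lam) * m n := fun n => by
    simpa only [hm, Nat.cast_add, Nat.cast_one] using gegenIntegral_sq_succ hlam n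
  have hc : ∀ n, M ≤ n → c n = 0 := fun n hn => by rw [hcb, hbM n hn, mul_zero]
  have hcoef : ∀ n, gegenIntegral hlam (p * gegenPolynomial lam n) = b n * m n := fun n => by
    rw [← hp, gegenIntegral_mul_gegenPolynomial, hcb]
    simp only [hm]
    ring
  have hstep : ∀ n : ℕ, 2 * (((n : ℝ) + 1 + lam) *
      gegenIntegral hlam (X * p * gegenPolynomial lam (n + 1))) =
        (n + 2) * m (n + 2) * b (n + 2) + (n + 2 * lam) * m n * b n := by
    intro n
    have e : (2 * ((n : ℝ) + 1 + lam)) • (X * p * gegenPolynomial lam (n + 1)) =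
        ((n : ℝ) + 2) • (p * gegenPolynomial lam (n + 2))
          + ((n : ℝ) + 2 * lam) • (p * gegenPolynomial lam n) := by
      simp only [smul_eq_C_mul, C_mul, C_add, map_natCast, map_ofNat, C_1]
      linear_combination -p * gegenPolynomial_recurrence lam n
    have h' := congrArg (gegenIntegral hlam) e
    simp only [map_add, map_smul, smul_eq_mul, hcoef] at h'
    linear_combination h'
  have hterm : ∀ n : ℕ, 2 * (c (n + 1) *
      gegenIntegral hlam ((1 - X) * p * gegenPolynomial lam (n + 1))) =
        2 * ((n : ℝ) + 1 + lam) * m (n + 1) * b (n + 1) ^ 2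
        - ((n : ℝ) + 2) * m (n + 2) * b (n + 1) * b (n + 2)
        - ((n : ℝ) + 1) * m (n + 1) * b n * b (n + 1) := by
    intro n
    have e : (1 - X) * p * gegenPolynomial lam (n + 1) =
        p * gegenPolynomial lam (n + 1) - X * p * gegenPolynomial lam (n + 1) := by ring
    rw [e, map_sub, hcoef, hcb]
    push_cast
    linear_combination -(b (n + 1)) * hstep n + b n * b (n + 1) * hmrec n
  have htele : ∀ n : ℕ, 2 * (c (n + 1) *
      gegenIntegral hlam ((1 - X) * p * gegenPolynomial lam (n + 1))) =
        ((n : ℝ) + 1) * m (n + 1) * (b (n + 1) - b n) ^ 2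
        + ((((n + 1 : ℕ) : ℝ) + 1) * m (n + 1 + 1) * (b (n + 1) ^ 2 - b (n + 1) * b (n + 1 + 1))
          - ((n : ℝ) + 1) * m (n + 1) * (b n ^ 2 - b n * b (n + 1))) := by
    intro n
    rw [hterm]
    have h := hmrec (n + 1)
    push_cast at h ⊢
    linear_combination -(b (n + 1)) ^ 2 * h
  rw [gegenIntegral_mul_self hlam c (M := M + 1) (fun n hn => hc n (by omega)) hp,
    Finset.sum_range_succ', hcb 0, hb0, mul_zero, zero_mul, add_zero, Finset.mul_sum]
  rw [Finset.sum_congr rfl fun n _ => htele n, Finset.sum_add_distrib]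
  rw [Finset.sum_range_sub (fun n : ℕ => ((n : ℝ) + 1) * m (n + 1) * (b n ^ 2 - b n * b (n + 1)))]
  simp [hb0, hbM M le_rfl, hm]

end Helpers

/-- **Theorem 3.4 (existence part).** For `λ > -1/2`, `λ ∉ {0, 1/2}`, there is a constant
`C_λ > 0` such that for every real polynomial `f` with `f̂_0^λ = 0`, with `g` the polynomial
with `ĝ_0^λ = 0` and `ĝ_n^λ = (n(n+2λ))^{1/2} f̂_n^λ` for `n ≥ 1`,
`c_λ ∫_{-1}^1 f² w_λ ≤ C_λ c_λ ∫_{-1}^1 (1-t) g² w_λ`. -/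
theorem hardy_rellich_gegenbauer_exists (lam : ℝ) (hlam : -1 / 2 < lam)
    (hlam0 : lam ≠ 0) (hlamhalf : lam ≠ 1 / 2) :
    ∃ C : ℝ, 0 < C ∧ ∀ f g : Polynomial ℝ,
      gegenCoeff lam (fun t => f.eval t) 0 = 0 →
      gegenCoeff lam (fun t => g.eval t) 0 = 0 →
      (∀ n : ℕ, 1 ≤ n →
        gegenCoeff lam (fun t => g.eval t) n =
          Real.sqrt ((n : ℝ) * ((n : ℝ) + 2 * lam)) * gegenCoeff lam (fun t => f.eval t) n) →
      gegenConst lam * ∫ t in (-1 : ℝ)..1, (f.eval t) ^ 2 * gegenWeight lam t ≤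
        C * (gegenConst lam * ∫ t in (-1 : ℝ)..1, (1 - t) * (g.eval t) ^ 2 * gegenWeight lam t) := by
  set K : ℝ := 3 + 2 * |lam| with hK
  set K' : ℝ := 2 * (1 + |lam| / (1 + 2 * lam)) with hK'
  have h2lam : 0 < 1 + 2 * lam := by linarith
  have hδ : 0 < (2 * lam - 1) ^ 2 := by
    have : 2 * lam - 1 ≠ 0 := fun h => hlamhalf (by linarith)
    positivity
  have hKpos : 0 < K := by positivity
  have hK'pos : 0 < K' := by positivity
  refine ⟨K' * (4 * K / (2 * lam - 1) ^ 2), by positivity, fun f g hf0 hg0 hfg => ?_⟩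
  have hc := gegenConst_pos hlam
  rw [mul_left_comm]
  refine mul_le_mul_of_nonneg_left ?_ hc.le
  obtain ⟨α, hα⟩ := exists_gegen_expansion hlam hlam0 f
  obtain ⟨β, hβ⟩ := exists_gegen_expansion hlam hlam0 g
  obtain ⟨M, hM⟩ : ∃ M, ∀ n, M ≤ n → α n = 0 ∧ β n = 0 := by
    refine ⟨(α.support ∪ β.support).sup id + 1, fun n hn => ?_⟩
    have : n ∉ α.support ∪ β.support := fun h => by
      have := Finset.le_sup (f := id) h
      simp only [id] at this
      omega
    simpa using this
  set N : ℕ → ℝ := fun n => gegenIntegral hlam (gegenPolynomial lam n ^ 2) with hN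
  have hNpos : ∀ n, 0 < N n := pos_of_gegen_recurrence hlam hlam0
    (by simpa [hN, gegenPolynomial] using gegenIntegral_one_pos hlam) (gegenIntegral_sq_succ hlam)
  have coeff : ∀ (c : ℕ →₀ ℝ) (p : Polynomial ℝ) (n : ℕ),
      (c.sum fun i a => a • gegenPolynomial lam i) = p →
      gegenCoeff lam (fun t => p.eval t) n =
        ((Real.sqrt (gegenNorm lam n))⁻¹ * gegenConst lam * N n) * c n := by
    rintro c _ n rfl
    rw [gegenCoeff_eval hlam, gegenIntegral_mul_gegenPolynomial]
    ring
  have hfac : ∀ n, (Real.sqrt (gegenNorm lam n))⁻¹ * gegenConst lam * N n ≠ 0 := fun n => by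
    have := Real.sqrt_pos.mpr (gegenNorm_pos hlam hlam0 n)
    have := hNpos n
    positivity
  rw [coeff α f 0 hα] at hf0
  rw [coeff β g 0 hβ] at hg0
  have hα0 : α 0 = 0 := (mul_eq_zero.mp hf0).resolve_left (hfac 0)
  have hβ0 : β 0 = 0 := (mul_eq_zero.mp hg0).resolve_left (hfac 0)
  have hαβ : ∀ n : ℕ, 1 ≤ n → β n ^ 2 = n * (n + 2 * lam) * α n ^ 2 := by
    intro n hn
    have h := hfg n hn
    rw [coeff α f n hα, coeff β g n hβ, mul_left_comm] at h
    have hn' : (1 : ℝ) ≤ n := by exact_mod_cast hn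
    rw [mul_left_cancel₀ (hfac n) h, mul_pow, Real.sq_sqrt]
    exact mul_nonneg (by linarith) (by linarith)
  have hnl : ∀ n : ℕ, (n : ℝ) + lam ≠ 0 := by
    rintro (_ | n)
    · simpa using hlam0
    · have : (0 : ℝ) ≤ n := n.cast_nonneg
      push_cast
      linarith
  set m : ℕ → ℝ := fun n => ((n : ℝ) + lam) * N n with hm
  set b : ℕ → ℝ := fun n => β n / ((n : ℝ) + lam) with hb
  have hβb : ∀ n : ℕ, β n = ((n : ℝ) + lam) * b n := fun n => by
    rw [hb]
    field_simp [hnl n]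
  have hb0 : b 0 = 0 := by simp [hb, hβ0]
  have hbM : ∀ n, M ≤ n → b n = 0 := fun n hn => by simp [hb, (hM n hn).2]
  have hmpos : ∀ n, 0 < m (n + 1) := fun n => by
    have : (0 : ℝ) ≤ n := n.cast_nonneg
    refine mul_pos ?_ (hNpos _)
    push_cast
    linarith
  have hmrec : ∀ n : ℕ, ((n : ℝ) + 1) * m (n + 1) = (n + 2 * lam) * m n := fun n => by
    simpa only [hm, hN, Nat.cast_add, Nat.cast_one] using gegenIntegral_sq_succ hlam n
  have hardy := discrete_hardy hmpos hmrec hb0 (hbM M le_rfl)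
  have energy := gegenIntegral_energy hlam β hβ hβb hb0 hbM
  set S := ∑ n ∈ Finset.range M, m n * b n ^ 2 / (n + 1) with hS
  have left : ∫ t in (-1 : ℝ)..1, f.eval t ^ 2 * gegenWeight lam t ≤ K' * S := by
    have e : ∫ t in (-1 : ℝ)..1, f.eval t ^ 2 * gegenWeight lam t = gegenIntegral hlam (f * f) := by
      simp only [gegenIntegral_apply, Polynomial.eval_mul, sq]
    rw [e, gegenIntegral_mul_self hlam α (fun n hn => (hM n hn).1) hα, hS, Finset.mul_sum]
    refine Finset.sum_le_sum fun n _ => ?_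
    have e2 : gegenIntegral hlam (f * gegenPolynomial lam n) = α n * N n := by
      rw [← hα, gegenIntegral_mul_gegenPolynomial]
    rw [e2]
    rcases n with _ | n
    · simp [hα0, hb0]
    · have hn : (0 : ℝ) ≤ n := n.cast_nonneg
      have h1 := hαβ (n + 1) (by omega)
      rw [hβb] at h1
      have hN1 := hNpos (n + 1)
      have hl : 0 < (n : ℝ) + 1 + lam := by linarith
      push_cast at h1 ⊢
      have e3 : m (n + 1) * b (n + 1) ^ 2 =
          α (n + 1) ^ 2 * N (n + 1) * (((n : ℝ) + 1) * (n + 1 + 2 * lam) / (n + 1 + lam)) := by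
        rw [← mul_div_assoc, eq_div_iff hl.ne']
        simp only [hm]
        push_cast
        linear_combination N (n + 1) * h1
      have e4 : 1 ≤ K' * (((n : ℝ) + 1) * (n + 1 + 2 * lam) / (n + 1 + lam) / (n + 1 + 1)) := by
        have h3 : (n : ℝ) + 1 + lam ≤ (1 + |lam| / (1 + 2 * lam)) * (n + 1 + 2 * lam) := by
          have h4 : |lam| ≤ |lam| / (1 + 2 * lam) * (n + 1 + 2 * lam) := by
            rw [div_mul_eq_mul_div, le_div_iff₀ h2lam]
            gcongr
            linarith
          have := neg_abs_le lam
          linarith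
        rw [div_div, ← mul_div_assoc, one_le_div (by positivity)]
        have h6 := hl.le.trans h3
        have h5 : (n : ℝ) + 1 + 1 ≤ 2 * (n + 1) := by linarith
        calc ((n : ℝ) + 1 + lam) * (n + 1 + 1)
            ≤ ((1 + |lam| / (1 + 2 * lam)) * (n + 1 + 2 * lam)) * (2 * (n + 1)) := by gcongr
          _ = _ := by rw [hK']; ring
      rw [e3]
      calc α (n + 1) * (α (n + 1) * N (n + 1)) = α (n + 1) ^ 2 * N (n + 1) * 1 := by ring
        _ ≤ α (n + 1) ^ 2 * N (n + 1) *
            (K' * (((n : ℝ) + 1) * (n + 1 + 2 * lam) / (n + 1 + lam) / (n + 1 + 1))) := by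
          gcongr
        _ = _ := by ring
  have e : ∫ t in (-1 : ℝ)..1, (1 - t) * g.eval t ^ 2 * gegenWeight lam t =
      gegenIntegral hlam ((1 - Polynomial.X) * g * g) := by
    simp only [gegenIntegral_apply, Polynomial.eval_mul, Polynomial.eval_sub, Polynomial.eval_one,
      Polynomial.eval_X, sq, mul_assoc]
  rw [e]
  refine left.trans ?_
  rw [mul_assoc K']
  refine mul_le_mul_of_nonneg_left ?_ hK'pos.le
  rw [div_mul_eq_mul_div, le_div_iff₀ hδ]
  simp only [hm, hN] at hardy
  rw [← energy, ← hK] at hardy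
  linarith
end

section
/- Let λ = 1/2, so that w_{1/2} ≡ 1 and c_{1/2} = 1/2 (the Legendre case). For every constant C > 0 and every nonnegative integer n₀, there exists a real polynomial f whose Legendre (Gegenbauer λ=1/2) coefficients satisfy f̂_j^{1/2} = 0 for all 0 ≤ j ≤ n₀ such that, with g the polynomial with ĝ_0^{1/2} = 0 and ĝ_n^{1/2} = (n(n+1))^{1/2} f̂_n^{1/2} for n ≥ 1, one has (1/2)∫_{−1}^{1} f(t)² dt > C · (1/2)∫_{−1}^{1} (1−t) g(t)² dt. In other words, the Hardy–Rellich inequality fails with every finite constant when λ = 1/2. -/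
open MeasureTheory Real

open Polynomial in
/-- The Legendre polynomials as elements of `ℝ[X]`. -/
noncomputable def legendreP : ℕ → ℝ[X]
  | 0 => 1
  | 1 => X
  | (n + 2) => C ((n : ℝ) + 2)⁻¹ *
      (C (2 * (n : ℝ) + 3) * X * legendreP (n + 1) - C ((n : ℝ) + 1) * legendreP n)

theorem eval_legendreP (n : ℕ) (t : ℝ) :
    (legendreP n).eval t = gegenPoly (1 / 2) n t := by
  induction n using Nat.twoStepInduction with
  | zero => simp [legendreP, gegenPoly]
  | one => simp [legendreP, gegenPoly]
  | more n ih0 ih1 =>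
    simp only [legendreP, gegenPoly, Polynomial.eval_mul, Polynomial.eval_sub,
      Polynomial.eval_C, Polynomial.eval_X, ih0, ih1]
    field_simp
    ring

theorem legendreP_add_two (n : ℕ) :
    ((n : Polynomial ℝ) + 2) * legendreP (n + 2) =
      (2 * (n : Polynomial ℝ) + 3) * Polynomial.X * legendreP (n + 1)
        - ((n : Polynomial ℝ) + 1) * legendreP n := by
  have h : ((n : Polynomial ℝ) + 2) * Polynomial.C ((n : ℝ) + 2)⁻¹ = 1 := by
    have : ((n : Polynomial ℝ) + 2) = Polynomial.C ((n : ℝ) + 2) := by simp [map_ofNat]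
    rw [this, ← Polynomial.C_mul, mul_inv_cancel₀ (by positivity), Polynomial.C_1]
  rw [legendreP, ← mul_assoc, h]
  simp [map_ofNat]

theorem X_mul_legendreP (n : ℕ) :
    (2 * (n : Polynomial ℝ) + 1) * (Polynomial.X * legendreP n) =
      ((n : Polynomial ℝ) + 1) * legendreP (n + 1) + (n : Polynomial ℝ) * legendreP (n - 1) := by
  cases n with
  | zero => simp [legendreP]
  | succ n =>
    have := legendreP_add_two n
    simp only [Nat.add_sub_cancel]
    push_cast
    linear_combination -this

theorem derivative_legendreP_aux (n : ℕ) :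
    Polynomial.derivative (legendreP (n + 1)) =
        Polynomial.X * Polynomial.derivative (legendreP n)
          + ((n : Polynomial ℝ) + 1) * legendreP n ∧
      Polynomial.X * Polynomial.derivative (legendreP (n + 1))
          - Polynomial.derivative (legendreP n) =
        ((n : Polynomial ℝ) + 1) * legendreP (n + 1) := by
  induction n with
  | zero => simp [legendreP]
  | succ n ih =>
    obtain ⟨hA, hB⟩ := ih
    have hr := legendreP_add_two n
    have hd := congrArg Polynomial.derivative hr
    simp only [Polynomial.derivative_mul, Polynomial.derivative_sub, Polynomial.derivative_add,
      Polynomial.derivative_natCast, Polynomial.derivative_ofNat, Polynomial.derivative_X,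
      Polynomial.derivative_one] at hd
    have hne : ((n : Polynomial ℝ) + 2) ≠ 0 := by exact_mod_cast (Nat.succ_ne_zero (n + 1))
    have hA' : Polynomial.derivative (legendreP (n + 2)) =
        Polynomial.X * Polynomial.derivative (legendreP (n + 1))
          + ((n : Polynomial ℝ) + 2) * legendreP (n + 1) := by
      apply mul_left_cancel₀ hne
      linear_combination hd + ((n : Polynomial ℝ) + 1) * hB
    push_cast
    refine ⟨by linear_combination hA', ?_⟩
    linear_combination Polynomial.X * hA' - hA + Polynomial.X * hB - hr

theorem derivative_legendreP_sub (n : ℕ) :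
    Polynomial.derivative (legendreP (n + 2) - legendreP n) =
      (2 * (n : ℝ) + 3) • legendreP (n + 1) := by
  have hA := (derivative_legendreP_aux (n + 1)).1
  have hB := (derivative_legendreP_aux n).2
  rw [Polynomial.smul_eq_C_mul, Polynomial.derivative_sub]
  push_cast at hA
  simp only [map_add, map_mul, Polynomial.C_ofNat, map_natCast]
  linear_combination hA + hB

theorem eval_one_legendreP (n : ℕ) : (legendreP n).eval 1 = 1 := by
  induction n using Nat.twoStepInduction with
  | zero => simp [legendreP]
  | one => simp [legendreP]
  | more n ih0 ih1 =>
    simp only [legendreP, Polynomial.eval_mul, Polynomial.eval_sub,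
      Polynomial.eval_C, Polynomial.eval_X, ih0, ih1]
    field_simp
    ring

theorem eval_neg_one_legendreP (n : ℕ) : (legendreP n).eval (-1) = (-1) ^ n := by
  induction n using Nat.twoStepInduction with
  | zero => simp [legendreP]
  | one => simp [legendreP]
  | more n ih0 ih1 =>
    simp only [legendreP, Polynomial.eval_mul, Polynomial.eval_sub,
      Polynomial.eval_C, Polynomial.eval_X, ih0, ih1]
    field_simp
    ring

/-- Integration over `[-1, 1]` as a linear functional on real polynomials. -/
noncomputable def polyIntegral : Polynomial ℝ →ₗ[ℝ] ℝ where
  toFun p := ∫ t in (-1 : ℝ)..1, p.eval t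
  map_add' p q := by
    simp only [Polynomial.eval_add]
    exact intervalIntegral.integral_add (p.continuous.intervalIntegrable _ _)
      (q.continuous.intervalIntegrable _ _)
  map_smul' c p := by simp

theorem polyIntegral_apply (p : Polynomial ℝ) :
    polyIntegral p = ∫ t in (-1 : ℝ)..1, p.eval t := rfl

theorem polyIntegral_derivative (p : Polynomial ℝ) :
    polyIntegral (Polynomial.derivative p) = p.eval 1 - p.eval (-1) := by
  rw [polyIntegral_apply]
  exact intervalIntegral.integral_eq_sub_of_hasDerivAt (fun t _ => p.hasDerivAt t)
    ((Polynomial.derivative p).continuous.intervalIntegrable _ _)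

theorem polyIntegral_legendreP_succ (n : ℕ) : polyIntegral (legendreP (n + 1)) = 0 := by
  have h := polyIntegral_derivative (legendreP (n + 2) - legendreP n)
  rw [derivative_legendreP_sub, map_smul, Polynomial.eval_sub, Polynomial.eval_sub,
    eval_one_legendreP, eval_one_legendreP, eval_neg_one_legendreP, eval_neg_one_legendreP,
    smul_eq_mul, pow_add] at h
  have hpos : (2 * (n : ℝ) + 3) ≠ 0 := by positivity
  exact (mul_eq_zero.mp (by linarith)).resolve_left hpos

theorem polyIntegral_X_mul_legendreP (n : ℕ) (q : Polynomial ℝ) :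
    (2 * (n : ℝ) + 1) * polyIntegral (Polynomial.X * legendreP n * q) =
      ((n : ℝ) + 1) * polyIntegral (legendreP (n + 1) * q)
        + (n : ℝ) * polyIntegral (legendreP (n - 1) * q) := by
  simp only [← smul_eq_mul (a := (_ : ℝ)), ← map_smul, ← map_add]
  congr 1
  simp only [Polynomial.smul_eq_C_mul, smul_eq_mul, map_add, map_mul, Polynomial.C_ofNat,
    map_natCast, Polynomial.C_1]
  linear_combination q * X_mul_legendreP n

theorem polyIntegral_legendreP_mul_of_lt (m : ℕ) :
    ∀ n, m < n → polyIntegral (legendreP m * legendreP n) = 0 := by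
  induction m using Nat.strong_induction_on with
  | _ m ih =>
    intro n hn
    obtain ⟨k, rfl⟩ : ∃ k, n = k + 1 := ⟨n - 1, by omega⟩
    cases m with
    | zero => simpa [legendreP] using polyIntegral_legendreP_succ k
    | succ m =>
      have h1 := polyIntegral_X_mul_legendreP m (legendreP (k + 1))
      have h2 := polyIntegral_X_mul_legendreP (k + 1) (legendreP m)
      have e1 : polyIntegral (legendreP (m - 1) * legendreP (k + 1)) = 0 :=
        ih _ (by omega) _ (by omega)
      have e2 : polyIntegral (legendreP (k + 1 + 1) * legendreP m) = 0 := by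
        rw [mul_comm]; exact ih _ (by omega) _ (by omega)
      have e3 : polyIntegral (legendreP (k + 1 - 1) * legendreP m) = 0 := by
        rw [mul_comm]; exact ih _ (by omega) _ (by omega)
      have e4 : Polynomial.X * legendreP (k + 1) * legendreP m =
        Polynomial.X * legendreP m * legendreP (k + 1) := by ring
      rw [e2, e3, e4] at h2
      have h3 : polyIntegral (Polynomial.X * legendreP m * legendreP (k + 1)) = 0 := by
        have : (2 * ((k + 1 : ℕ) : ℝ) + 1) ≠ 0 := by positivity
        exact (mul_eq_zero.mp (by linarith)).resolve_left this
      rw [h3, e1] at h1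
      have : ((m : ℝ) + 1) ≠ 0 := by positivity
      exact (mul_eq_zero.mp (by linarith)).resolve_left this

theorem polyIntegral_legendreP_mul_of_ne {m n : ℕ} (h : m ≠ n) :
    polyIntegral (legendreP m * legendreP n) = 0 := by
  rcases lt_or_gt_of_ne h with h | h
  · exact polyIntegral_legendreP_mul_of_lt m n h
  · rw [mul_comm]; exact polyIntegral_legendreP_mul_of_lt n m h

theorem polyIntegral_legendreP_sq (n : ℕ) :
    (2 * (n : ℝ) + 1) * polyIntegral (legendreP n * legendreP n) = 2 := by
  induction n with
  | zero => simp [legendreP, polyIntegral_apply]; norm_num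
  | succ n ih =>
    have h1 := polyIntegral_X_mul_legendreP n (legendreP (n + 1))
    have h2 := polyIntegral_X_mul_legendreP (n + 1) (legendreP n)
    rw [polyIntegral_legendreP_mul_of_ne (m := n - 1) (by omega)] at h1
    rw [polyIntegral_legendreP_mul_of_ne (m := n + 1 + 1) (by omega), Nat.add_sub_cancel,
      show Polynomial.X * legendreP (n + 1) * legendreP n =
        Polynomial.X * legendreP n * legendreP (n + 1) by ring] at h2
    have : ((n : ℝ) + 1) ≠ 0 := by positivity
    apply mul_left_cancel₀ this
    push_cast at h2 ⊢
    linear_combination (-2 * (n : ℝ) - 3) * h1 + (2 * (n : ℝ) + 1) * h2 + ((n : ℝ) + 1) * ih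

/-- The partial Legendre expansion `∑_{n < N} (2n+1) a_n P_n`. -/
noncomputable def legendreSum (a : ℕ → ℝ) (N : ℕ) : Polynomial ℝ :=
  ∑ n ∈ Finset.range N, (a n * (2 * (n : ℝ) + 1)) • legendreP n

theorem polyIntegral_legendreSum_mul (a : ℕ → ℝ) (N m : ℕ) :
    polyIntegral (legendreSum a N * legendreP m) = if m < N then 2 * a m else 0 := by
  have key : ∀ n, polyIntegral ((a n * (2 * (n : ℝ) + 1)) • legendreP n * legendreP m) =
      if m = n then 2 * a m else 0 := by
    intro n
    rw [smul_mul_assoc, map_smul, smul_eq_mul]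
    split_ifs with h
    · subst h
      linear_combination a m * polyIntegral_legendreP_sq m
    · rw [polyIntegral_legendreP_mul_of_ne (Ne.symm h), mul_zero]
  simp only [legendreSum, Finset.sum_mul, map_sum, key]
  simp

theorem polyIntegral_legendreSum_sq (a : ℕ → ℝ) (N : ℕ) :
    polyIntegral (legendreSum a N * legendreSum a N) =
      2 * ∑ n ∈ Finset.range N, (2 * (n : ℝ) + 1) * a n ^ 2 := by
  conv_lhs => enter [2, 2]; rw [legendreSum]
  rw [Finset.mul_sum, map_sum, Finset.mul_sum]
  refine Finset.sum_congr rfl fun n hn => ?_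
  rw [mul_smul_comm, map_smul, polyIntegral_legendreSum_mul, if_pos (Finset.mem_range.mp hn),
    smul_eq_mul]
  ring

theorem polyIntegral_one_sub_X_mul_legendreSum_sq (u : ℕ → ℝ) (N : ℕ) :
    polyIntegral ((1 - Polynomial.X) * (legendreSum u N * legendreSum u N)) =
      2 * (∑ n ∈ Finset.range N, ((n : ℝ) + 1) * (u n - u (n + 1)) ^ 2
        + 2 * N * u (N - 1) * u N - N * u N ^ 2) := by
  induction N with
  | zero => simp [legendreSum]
  | succ N ih =>
    have hS : legendreSum u (N + 1) = legendreSum u N + (u N * (2 * (N : ℝ) + 1)) • legendreP N := by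
      simp [legendreSum, Finset.sum_range_succ]
    set c := u N * (2 * (N : ℝ) + 1) with hc
    have hexp : (1 - Polynomial.X) * (legendreSum u (N + 1) * legendreSum u (N + 1)) =
        (1 - Polynomial.X) * (legendreSum u N * legendreSum u N)
          + (2 * c) • (legendreSum u N * legendreP N)
          - (2 * c) • (Polynomial.X * legendreP N * legendreSum u N)
          + (c ^ 2) • (legendreP N * legendreP N)
          - (c ^ 2) • (Polynomial.X * legendreP N * legendreP N) := by
      rw [hS]
      simp only [Polynomial.smul_eq_C_mul, map_mul, map_pow, Polynomial.C_ofNat]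
      ring
    have h1 : polyIntegral (legendreSum u N * legendreP N) = 0 := by
      simp [polyIntegral_legendreSum_mul]
    have h2 : (2 * (N : ℝ) + 1) * polyIntegral (Polynomial.X * legendreP N * legendreSum u N) =
        2 * N * u (N - 1) := by
      rw [polyIntegral_X_mul_legendreP, mul_comm (legendreP _), mul_comm (legendreP _),
        polyIntegral_legendreSum_mul, polyIntegral_legendreSum_mul]
      rcases N with _ | N
      · simp
      · simp; ring
    have h3 := polyIntegral_legendreP_sq N
    have h4 : polyIntegral (Polynomial.X * legendreP N * legendreP N) = 0 := by
      have h := polyIntegral_X_mul_legendreP N (legendreP N)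
      rw [polyIntegral_legendreP_mul_of_ne (m := N + 1) (by omega)] at h
      have h' : (N : ℝ) * polyIntegral (legendreP (N - 1) * legendreP N) = 0 := by
        rcases N with _ | N
        · simp
        · rw [polyIntegral_legendreP_mul_of_ne (by omega), mul_zero]
      rw [h'] at h
      have : (2 * (N : ℝ) + 1) ≠ 0 := by positivity
      exact (mul_eq_zero.mp (by linarith)).resolve_left this
    rw [hexp]
    simp only [map_add, map_sub, map_smul, smul_eq_mul, ih, h1, h4, Finset.sum_range_succ,
      Nat.add_sub_cancel]
    push_cast
    rw [hc]
    linear_combination (-2 * u N) * h2 + (u N ^ 2 * (2 * N + 1)) * h3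

theorem gegenCoeff_half_eval (f : Polynomial ℝ) (n : ℕ) :
    gegenCoeff (1 / 2) (fun t => f.eval t) n =
      (Real.sqrt (gegenNorm (1 / 2) n))⁻¹ * gegenConst (1 / 2) *
        polyIntegral (f * legendreP n) := by
  simp [gegenCoeff, gegenWeight, polyIntegral_apply, eval_legendreP]

/-- A finitely supported logarithmic cutoff: its weighted Dirichlet energy stays bounded while its
weighted `ℓ²` mass is as large as desired. -/
theorem exists_log_cutoff (K : ℝ) (n₀ : ℕ) :
    ∃ (u : ℕ → ℝ) (N : ℕ), (∀ n, n ≤ n₀ → u n = 0) ∧ (∀ n, N ≤ n → u n = 0) ∧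
      ∑ n ∈ Finset.range N, ((n : ℝ) + 1) * (u n - u (n + 1)) ^ 2 ≤ (n₀ : ℝ) + 2 ∧
      K < ∑ n ∈ Finset.range N, u n ^ 2 / ((n : ℝ) + 1) := by
  set H : ℕ → ℝ := fun n => ∑ i ∈ Finset.range n, 1 / ((i : ℝ) + 1) with hH
  have hlim : Filter.Tendsto H Filter.atTop Filter.atTop :=
    Real.tendsto_sum_range_one_div_nat_succ_atTop
  have hsucc : ∀ n, H (n + 1) = H n + 1 / ((n : ℝ) + 1) := fun n => Finset.sum_range_succ _ _
  have hmono : Monotone H := monotone_nat_of_le_succ fun n => by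
    rw [hsucc]; have : 0 < 1 / ((n : ℝ) + 1) := by positivity
    linarith
  obtain ⟨A, hA, hKA⟩ : ∃ A, n₀ + 1 ≤ A ∧ K + H (n₀ + 1) < H A := by
    obtain ⟨A, h⟩ := ((Filter.eventually_ge_atTop (n₀ + 1)).and
      (hlim.eventually_gt_atTop (K + H (n₀ + 1)))).exists
    exact ⟨A, h⟩
  obtain ⟨N, hAN, hN⟩ : ∃ N, A ≤ N ∧ H A + 1 ≤ H N := by
    obtain ⟨N, h⟩ := ((Filter.eventually_ge_atTop A).and
      (hlim.eventually_ge_atTop (H A + 1))).exists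
    exact ⟨N, h⟩
  set v : ℕ → ℝ := fun n => min 1 (max 0 (1 + H A - H n)) with hv
  have hv1 : ∀ n, v n ≤ 1 := fun n => min_le_left _ _
  have hvA : ∀ n, n ≤ A → v n = 1 := fun n hn =>
    min_eq_left (le_max_of_le_right (by have := hmono hn; linarith))
  have hvN : ∀ n, N ≤ n → v n = 0 := fun n hn => by
    have := hmono hn
    simp only [hv]
    rw [max_eq_left (by linarith), min_eq_right zero_le_one]
  have hstep0 : ∀ n, 0 ≤ v n - v (n + 1) := fun n => by
    have := hmono n.le_succ
    exact sub_nonneg.mpr (min_le_min_left _ (max_le_max_left _ (by linarith)))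
  have hstep1 : ∀ n : ℕ, v n - v (n + 1) ≤ 1 / ((n : ℝ) + 1) := fun n => by
    have h := hsucc n
    have hp : 0 < 1 / ((n : ℝ) + 1) := by positivity
    have hmax : max 0 (1 + H A - H n) ≤ max 0 (1 + H A - H (n + 1)) + 1 / ((n : ℝ) + 1) :=
      max_le (by linarith [le_max_left 0 (1 + H A - H (n + 1))])
        (by linarith [le_max_right 0 (1 + H A - H (n + 1))])
    have hmin : v n - 1 / ((n : ℝ) + 1) ≤ v (n + 1) :=
      le_min (by linarith [hv1 n])
        (by linarith [min_le_right 1 (max 0 (1 + H A - H n))])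
    linarith
  have henergy : ∀ n : ℕ, ((n : ℝ) + 1) * (v n - v (n + 1)) ^ 2 ≤ v n - v (n + 1) := fun n => by
    have h := hstep1 n
    rw [le_div_iff₀ (by positivity)] at h
    nlinarith [hstep0 n]
  set u : ℕ → ℝ := fun n => if n ≤ n₀ then 0 else v n with hu
  have hulow : ∀ n, n ≤ n₀ → u n = 0 := fun n hn => if_pos hn
  have huhigh : ∀ n, n₀ < n → u n = v n := fun n hn => if_neg (by omega)
  refine ⟨u, N, hulow, fun n hn => ?_, ?_, ?_⟩
  · rw [huhigh n (by omega), hvN n hn]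
  · have hbound : ∀ M, ∑ n ∈ Finset.range M, ((n : ℝ) + 1) * (u n - u (n + 1)) ^ 2 ≤
        if M ≤ n₀ then 0 else (n₀ : ℝ) + 2 - v M := by
      intro M
      induction M with
      | zero => simp
      | succ M ih =>
        rw [Finset.sum_range_succ]
        rcases lt_trichotomy M n₀ with h | h | h
        · rw [if_pos (by omega)] at ih ⊢
          rw [hulow M (by omega), hulow (M + 1) (by omega)]
          simpa using ih
        · subst h
          rw [if_pos le_rfl] at ih
          rw [if_neg (by omega), hulow M le_rfl, huhigh (M + 1) (by omega), hvA (M + 1) hA]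
          nlinarith
        · rw [if_neg (by omega)] at ih ⊢
          rw [huhigh M h, huhigh (M + 1) (by omega)]
          linarith [henergy M]
    have h := hbound N
    rw [if_neg (by omega), hvN N le_rfl] at h
    linarith
  · calc K < H A - H (n₀ + 1) := by linarith
      _ = ∑ n ∈ Finset.Ico (n₀ + 1) A, 1 / ((n : ℝ) + 1) := (Finset.sum_Ico_eq_sub _ hA).symm
      _ = ∑ n ∈ Finset.Ico (n₀ + 1) A, u n ^ 2 / ((n : ℝ) + 1) := by
        refine Finset.sum_congr rfl fun n hn => ?_
        rw [Finset.mem_Ico] at hn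
        rw [huhigh n (by omega), hvA n (by omega), one_pow]
      _ ≤ ∑ n ∈ Finset.range N, u n ^ 2 / ((n : ℝ) + 1) := by
        refine Finset.sum_le_sum_of_subset_of_nonneg (fun n hn => ?_) fun n _ _ => by positivity
        rw [Finset.mem_Ico] at hn
        exact Finset.mem_range.mpr (by omega)

/-- **Failure of the Hardy–Rellich inequality in the Legendre case `λ = 1/2`.**
For every `C > 0` and `n₀ ∈ ℕ` there exists a real polynomial `f` with
`f̂_j^{1/2} = 0` for `0 ≤ j ≤ n₀` such that, with `g` the polynomial with `ĝ_0^{1/2} = 0`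
and `ĝ_n^{1/2} = (n(n+1))^{1/2} f̂_n^{1/2}` for `n ≥ 1`,
`(1/2) ∫_{-1}^1 f(t)² dt > C (1/2) ∫_{-1}^1 (1-t) g(t)² dt`. -/
theorem hardy_rellich_fails_legendre (C : ℝ) (hC : 0 < C) (n₀ : ℕ) :
    ∃ f g : Polynomial ℝ,
      (∀ j : ℕ, j ≤ n₀ → gegenCoeff (1 / 2) (fun t => f.eval t) j = 0) ∧
      gegenCoeff (1 / 2) (fun t => g.eval t) 0 = 0 ∧
      (∀ n : ℕ, 1 ≤ n →
        gegenCoeff (1 / 2) (fun t => g.eval t) n =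
          Real.sqrt ((n : ℝ) * ((n : ℝ) + 1)) * gegenCoeff (1 / 2) (fun t => f.eval t) n) ∧
      C * ((1 / 2) * ∫ t in (-1 : ℝ)..1, (1 - t) * (g.eval t) ^ 2) <
        (1 / 2) * ∫ t in (-1 : ℝ)..1, (f.eval t) ^ 2 := by
  obtain ⟨u, N, hlow, hhigh, henergy, hmass⟩ := exists_log_cutoff (C * (n₀ + 2)) n₀
  set a : ℕ → ℝ := fun n => u n / Real.sqrt ((n : ℝ) * ((n : ℝ) + 1)) with ha
  refine ⟨legendreSum a N, legendreSum u N, fun j hj => ?_, ?_, fun n hn => ?_, ?_⟩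
  · rw [gegenCoeff_half_eval, polyIntegral_legendreSum_mul]
    simp [ha, hlow j hj]
  · rw [gegenCoeff_half_eval, polyIntegral_legendreSum_mul]
    simp [hlow 0 (Nat.zero_le _)]
  · rw [gegenCoeff_half_eval, gegenCoeff_half_eval, polyIntegral_legendreSum_mul,
      polyIntegral_legendreSum_mul]
    have hn' : (0 : ℝ) < n := by exact_mod_cast hn
    have hs : Real.sqrt ((n : ℝ) * ((n : ℝ) + 1)) ≠ 0 := (Real.sqrt_pos.mpr (by positivity)).ne'
    have hua : u n = Real.sqrt ((n : ℝ) * ((n : ℝ) + 1)) * a n := by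
      simp only [ha]
      rw [mul_div_cancel₀ _ hs]
    split_ifs
    · rw [hua]
      ring
    · ring
  · have hg : ∫ t in (-1 : ℝ)..1, (1 - t) * ((legendreSum u N).eval t) ^ 2 =
        2 * ∑ n ∈ Finset.range N, ((n : ℝ) + 1) * (u n - u (n + 1)) ^ 2 := by
      have h := polyIntegral_one_sub_X_mul_legendreSum_sq u N
      rw [hhigh N le_rfl, polyIntegral_apply] at h
      simpa [pow_two] using h
    have hf : ∫ t in (-1 : ℝ)..1, ((legendreSum a N).eval t) ^ 2 =
        2 * ∑ n ∈ Finset.range N, (2 * (n : ℝ) + 1) * a n ^ 2 := by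
      rw [← polyIntegral_legendreSum_sq, polyIntegral_apply]
      simp [pow_two]
    have hle : ∑ n ∈ Finset.range N, u n ^ 2 / ((n : ℝ) + 1) ≤
        ∑ n ∈ Finset.range N, (2 * (n : ℝ) + 1) * a n ^ 2 := by
      refine Finset.sum_le_sum fun n _ => ?_
      rcases Nat.eq_zero_or_pos n with rfl | hn
      · simp [ha, hlow 0 (Nat.zero_le _)]
      · have hn' : (0 : ℝ) < n := by exact_mod_cast hn
        simp only [ha]
        rw [div_pow, Real.sq_sqrt (by positivity), ← mul_div_assoc,
          div_le_div_iff₀ (by positivity) (by positivity)]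
        have : 0 ≤ u n ^ 2 * ((n : ℝ) + 1) ^ 2 := by positivity
        nlinarith [sq_nonneg (u n), mul_nonneg (mul_nonneg (sq_nonneg (u n)) hn'.le)
          (by positivity : (0 : ℝ) ≤ (n : ℝ) + 1)]
    rw [hg, hf]
    have := mul_le_mul_of_nonneg_left henergy hC.le
    linarith
end
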